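/- arXiv:2508.09968 — 5 statements merged into one kernel-verified Lean document; each statement's English description precedes it below -/
import Mathlib

section
/- Let 0 ≤ L < 1 and let f : ℝ^d → ℝ^d be continuously differentiable and L-Lipschitz continuous. Then T(x) = x + f(x) is a global C¹ diffeomorphism of ℝ^d: T is bijective, and there exists a continuously differentiable map S : ℝ^d → ℝ^d with S ∘ T = id and T ∘ S = id. -/
open scoped NNReal in
/-- A `C¹` perturbation `x ↦ x + f x` of the identity by a `K`-Lipschitz map with `K < 1` is
the underlying function of a homeomorphism with `C¹` inverse. -/
theorem LipschitzWith.exists_homeomorph_id_add_contDiff_symm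
    {E : Type*} [NormedAddCommGroup E] [NormedSpace ℝ E] [CompleteSpace E]
    {f : E → E} {K : ℝ≥0} (hf : LipschitzWith K f) (hK : K < 1) (hf_smooth : ContDiff ℝ 1 f) :
    ∃ T : E ≃ₜ E, (⇑T = fun x => x + f x) ∧ ContDiff ℝ 1 T.symm := by
  have happrox : ApproximatesLinearOn (fun x => x + f x)
      (ContinuousLinearEquiv.refl ℝ E : E →L[ℝ] E) Set.univ K := by
    rw [ApproximatesLinearOn.approximatesLinearOn_iff_lipschitzOnWith, lipschitzOnWith_univ]
    convert hf using 1
    ext x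
    simp
  have hc : Subsingleton E ∨
      K < ‖((ContinuousLinearEquiv.refl ℝ E).symm : E →L[ℝ] E)‖₊⁻¹ := by
    rcases subsingleton_or_nontrivial E with h | h
    · exact .inl h
    · right
      have hnorm : ‖((ContinuousLinearEquiv.refl ℝ E).symm : E →L[ℝ] E)‖₊ = 1 :=
        NNReal.eq ContinuousLinearMap.norm_id
      rwa [hnorm, inv_one]
  have hnorm_lt (x : E) : ‖-fderiv ℝ f x‖ < 1 := by
    rw [norm_neg]
    exact (norm_fderiv_le_of_lipschitz ℝ hf).trans_lt (by exact_mod_cast hK)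
  refine ⟨happrox.toHomeomorph _ hc, rfl, ?_⟩
  refine Homeomorph.contDiff_symm _
    (f₀' := fun x => ContinuousLinearEquiv.unitsEquiv ℝ E (Units.oneSub _ (hnorm_lt x)))
    (fun x => ?_) (contDiff_id.add hf_smooth)
  refine ((hasFDerivAt_id x).add
    (hf_smooth.differentiable one_ne_zero x).hasFDerivAt).congr_fderiv ?_
  ext v
  simp

/-- For a continuously differentiable `L`-Lipschitz map `f : ℝ^d → ℝ^d` with
`0 ≤ L < 1`, the residual map `T x = x + f x` is a global `C¹` diffeomorphism of `ℝ^d`: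
`T` is bijective and admits a continuously differentiable two-sided inverse `S`. -/
theorem residual_global_C1_diffeomorphism
    {d : ℕ} (L : ℝ) (hL0 : 0 ≤ L) (hL1 : L < 1)
    (f : EuclideanSpace ℝ (Fin d) → EuclideanSpace ℝ (Fin d))
    (hf_smooth : ContDiff ℝ 1 f)
    (hf_lip : ∀ x x' : EuclideanSpace ℝ (Fin d), ‖f x - f x'‖ ≤ L * ‖x - x'‖) :
    Function.Bijective (fun x => x + f x) ∧
    ∃ S : EuclideanSpace ℝ (Fin d) → EuclideanSpace ℝ (Fin d),
      ContDiff ℝ 1 S ∧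
      (S ∘ (fun x => x + f x)) = id ∧
      ((fun x => x + f x) ∘ S) = id := by
  lift L to NNReal using hL0
  obtain ⟨T, hT, hS⟩ := LipschitzWith.exists_homeomorph_id_add_contDiff_symm
    (LipschitzWith.of_dist_le_mul fun x y => by simpa [dist_eq_norm] using hf_lip x y)
    (by exact_mod_cast hL1) hf_smooth
  rw [← hT]
  exact ⟨T.bijective, T.symm, hS, T.symm_comp_self, T.self_comp_symm⟩
end

section
/- Let γ be the standard Gaussian measure on ℝ^d, i.e. the d-fold product of N(0,1), and let h : ℝ^d → ℝ^d be differentiable with Jacobian J_h(x) (the matrix of the Fréchet derivative of h at x). Assume x ↦ ⟨x, h(x)⟩ is integrable with respect to γ and x ↦ Tr(J_h(x)) is integrable with respect to γ. Then ∫ ⟨x, h(x)⟩ dγ(x) = ∫ Tr(J_h(x)) dγ(x). -/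
open MeasureTheory ProbabilityTheory

theorem pi_withDensity_ofReal {ι : Type*} [Fintype ι] {α : ι → Type*}
    [∀ i, MeasurableSpace (α i)] (μ : ∀ i, Measure (α i)) [∀ i, SigmaFinite (μ i)]
    {f : ∀ i, α i → ℝ} (hf : ∀ i, Integrable (f i) (μ i)) (hf0 : ∀ i x, 0 ≤ f i x) :
    Measure.pi (fun i => (μ i).withDensity fun x => ENNReal.ofReal (f i x)) =
      (Measure.pi μ).withDensity fun x => ENNReal.ofReal (∏ i, f i (x i)) := by
  have _ (i) : IsFiniteMeasure ((μ i).withDensity fun x => ENNReal.ofReal (f i x)) :=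
    isFiniteMeasure_withDensity_ofReal (hf i).2
  refine Measure.pi_eq fun s hs => ?_
  rw [withDensity_apply _ (.univ_pi hs), Measure.restrict_pi_pi,
    ← ofReal_integral_eq_lintegral_ofReal
      (Integrable.fintype_prod_dep fun i => (hf i).restrict)
      (ae_of_all _ fun x => Finset.prod_nonneg fun i _ => hf0 i _),
    integral_fintype_prod_eq_prod,
    ENNReal.ofReal_prod_of_nonneg fun i _ => integral_nonneg (hf0 i)]
  refine Finset.prod_congr rfl fun i _ => ?_
  rw [withDensity_apply _ (hs i), ofReal_integral_eq_lintegral_ofReal (hf i).restrict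
    (ae_of_all _ (hf0 i))]

theorem hasDerivAt_max_zero_sq (t : ℝ) :
    HasDerivAt (fun t : ℝ => max 0 t ^ 2) (2 * max 0 t) t := by
  refine hasDerivAt_of_hasDerivAt_of_ne' (f := fun t : ℝ => max 0 t ^ 2)
    (g := fun t => 2 * max 0 t) (x := 0) (fun y hy => ?_) (by fun_prop) (by fun_prop) t
  rcases hy.lt_or_gt with hy | hy
  · rw [max_eq_left hy.le, mul_zero]
    refine (hasDerivAt_const y (0 : ℝ)).congr_of_eventuallyEq ?_
    filter_upwards [Iio_mem_nhds hy] with z hz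
    simp [max_eq_left (Set.mem_Iio.1 hz).le]
  · rw [max_eq_right hy.le]
    have hpow : HasDerivAt (fun z : ℝ => z ^ 2) (2 * y) y := by simpa using hasDerivAt_pow 2 y
    refine hpow.congr_of_eventuallyEq ?_
    filter_upwards [Ioi_mem_nhds hy] with z hz
    simp [max_eq_right (Set.mem_Ioi.1 hz).le]

theorem integral_divergence_eq_zero_of_hasCompactSupport {d : ℕ}
    {f : (Fin d → ℝ) → Fin d → ℝ} (hf : Differentiable ℝ f) (hc : HasCompactSupport f)
    (hi : Integrable fun x => ∑ i, fderiv ℝ f x (Pi.single i 1) i) :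
    ∫ x, ∑ i, fderiv ℝ f x (Pi.single i 1) i = 0 := by
  cases d with
  | zero => simp
  | succ n =>
    obtain ⟨R, hR⟩ := hc.isCompact.isBounded.subset_ball 0
    have hlt {x : Fin (n + 1) → ℝ} (hx : x ∈ tsupport f) (i) : |x i| < R :=
      (norm_le_pi_norm x i).trans_lt (by simpa using hR hx)
    have hface (x : Fin (n + 1) → ℝ) (i) (hx : |x i| = |R|) : f x = 0 :=
      image_eq_zero_of_notMem_tsupport fun h =>
        absurd (hlt h i) (by rw [hx]; exact (le_abs_self R).not_gt)
    have hsupp : (Function.support fun x => ∑ i, fderiv ℝ f x (Pi.single i 1) i) ⊆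
        Set.Icc (fun _ => -|R|) (fun _ => |R|) := by
      intro x hx
      have hx' : x ∈ tsupport f := by
        by_contra h
        exact hx (by simp [Function.notMem_support.1 fun h' => h (support_fderiv_subset ℝ h')])
      have h (i) := abs_le.1 ((hlt hx' i).le.trans (le_abs_self R))
      exact ⟨fun i => (h i).1, fun i => (h i).2⟩
    rw [← setIntegral_eq_integral_of_forall_compl_eq_zero fun x hx =>
        Function.notMem_support.1 fun h => hx (hsupp h),
      integral_divergence_of_hasFDerivAt_off_countable _ _
        (fun i => neg_le_self (abs_nonneg R)) f (fderiv ℝ f) ∅ Set.countable_empty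
        hf.continuous.continuousOn (fun x _ => (hf x).hasFDerivAt) hi.integrableOn]
    refine Finset.sum_eq_zero fun i _ => ?_
    simp [hface _ i, Fin.insertNth_apply_same]

theorem prod_gaussianPDFReal {ι : Type*} [Fintype ι] (x : ι → ℝ) :
    ∏ i, gaussianPDFReal 0 1 (x i) =
      (√(2 * Real.pi))⁻¹ ^ Fintype.card ι * Real.exp (-(∑ i, x i ^ 2) / 2) := by
  simp [gaussianPDFReal, Finset.prod_mul_distrib, ← Real.exp_sum, Finset.sum_div, neg_div]

/-- The divergence of a vector field multiplied by a radial function. -/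
theorem divergence_radial_smul {d : ℕ} {h : (Fin d → ℝ) → Fin d → ℝ} {x : Fin d → ℝ}
    (hh : DifferentiableAt ℝ h x) {θ : ℝ → ℝ} {θ' : ℝ} (hθ : HasDerivAt θ θ' (∑ i, x i ^ 2)) :
    ∑ i, fderiv ℝ (fun y => θ (∑ j, y j ^ 2) • h y) x (Pi.single i 1) i =
      θ (∑ i, x i ^ 2) * ∑ i, fderiv ℝ h x (Pi.single i 1) i + 2 * θ' * ∑ i, x i * h x i := by
  have hsq : HasFDerivAt (fun y : Fin d → ℝ => ∑ j, y j ^ 2)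
      (∑ j, (2 * x j) • ContinuousLinearMap.proj (R := ℝ) (φ := fun _ : Fin d => ℝ) j) x := by
    refine HasFDerivAt.fun_sum fun j _ => ?_
    simpa using (hasFDerivAt_apply (𝕜 := ℝ) j x).pow 2
  have hw := (hθ.comp_hasFDerivAt x hsq).smul hh.hasFDerivAt
  rw [show fderiv ℝ (fun y => θ (∑ j, y j ^ 2) • h y) x = _ from hw.fderiv, Finset.mul_sum,
    Finset.mul_sum, ← Finset.sum_add_distrib]
  refine Finset.sum_congr rfl fun i _ => ?_
  simp [Pi.single_apply]
  ring

/-- Stein's identity for the field `h` multiplied by the cutoff `max 0 (1 - a * ‖x‖²) ^ 2`. -/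
theorem integral_cutoff_stein {d : ℕ} {h : (Fin d → ℝ) → Fin d → ℝ} (hdiff : Differentiable ℝ h)
    {a : ℝ} (ha : 0 < a)
    (hint : Integrable (fun x =>
      max 0 (1 - a * ∑ i, x i ^ 2) ^ 2 * ∑ i, fderiv ℝ h x (Pi.single i 1) i -
        (max 0 (1 - a * ∑ i, x i ^ 2) ^ 2 + 4 * a * max 0 (1 - a * ∑ i, x i ^ 2)) *
          ∑ i, x i * h x i) (Measure.pi fun _ : Fin d => gaussianReal 0 1)) :
    ∫ x, (max 0 (1 - a * ∑ i, x i ^ 2) ^ 2 * ∑ i, fderiv ℝ h x (Pi.single i 1) i -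
        (max 0 (1 - a * ∑ i, x i ^ 2) ^ 2 + 4 * a * max 0 (1 - a * ∑ i, x i ^ 2)) *
          ∑ i, x i * h x i) ∂(Measure.pi fun _ : Fin d => gaussianReal 0 1) = 0 := by
  have hγ : (Measure.pi fun _ : Fin d => gaussianReal 0 1) =
      volume.withDensity fun x => ENNReal.ofReal (∏ i, gaussianPDFReal 0 1 (x i)) := by
    simp_rw [gaussianReal_of_var_ne_zero 0 one_ne_zero, gaussianPDF_def]
    exact pi_withDensity_ofReal _ (fun _ => integrable_gaussianPDFReal 0 1)
      fun _ => gaussianPDFReal_nonneg 0 1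
  have hmeas : Measurable fun x : Fin d → ℝ =>
      ENNReal.ofReal (∏ i, gaussianPDFReal 0 1 (x i)) := by
    fun_prop
  have htop : ∀ᵐ x : Fin d → ℝ, ENNReal.ofReal (∏ i, gaussianPDFReal 0 1 (x i)) < ⊤ :=
    ae_of_all _ fun _ => ENNReal.ofReal_lt_top
  have hnn (x : Fin d → ℝ) : 0 ≤ ∏ i, gaussianPDFReal 0 1 (x i) :=
    Finset.prod_nonneg fun i _ => gaussianPDFReal_nonneg 0 1 (x i)
  rw [hγ, integrable_withDensity_iff_integrable_smul' hmeas htop] at hint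
  rw [hγ, integral_withDensity_eq_integral_toReal_smul hmeas htop]
  simp only [ENNReal.toReal_ofReal (hnn _), smul_eq_mul] at hint ⊢
  set c : ℝ := (√(2 * Real.pi))⁻¹ ^ Fintype.card (Fin d)
  set θ : ℝ → ℝ := fun t => c * Real.exp (-t / 2) * max 0 (1 - a * t) ^ 2 with hθdef
  have hθ (t : ℝ) : HasDerivAt θ (c * Real.exp (-t / 2) *
      (-(max 0 (1 - a * t) ^ 2) / 2 - 2 * a * max 0 (1 - a * t))) t := by
    have hlin : HasDerivAt (fun t => 1 - a * t) (-a) t := by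
      simpa using ((hasDerivAt_id t).const_mul a).const_sub 1
    have hexp : HasDerivAt (fun t => c * Real.exp (-t / 2))
        (c * (Real.exp (-t / 2) * (-1 / 2))) t :=
      (((hasDerivAt_id t).neg.div_const 2).exp).const_mul c
    refine (hexp.mul ((hasDerivAt_max_zero_sq _).comp t hlin)).congr_deriv ?_
    simp only [Function.comp_apply]
    ring
  have hdiv (x : Fin d → ℝ) :
      (∏ i, gaussianPDFReal 0 1 (x i)) *
        (max 0 (1 - a * ∑ i, x i ^ 2) ^ 2 * ∑ i, fderiv ℝ h x (Pi.single i 1) i -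
        (max 0 (1 - a * ∑ i, x i ^ 2) ^ 2 + 4 * a * max 0 (1 - a * ∑ i, x i ^ 2)) *
          ∑ i, x i * h x i) =
      ∑ i, fderiv ℝ (fun y => θ (∑ j, y j ^ 2) • h y) x (Pi.single i 1) i := by
    rw [divergence_radial_smul (hdiff x) (hθ _), prod_gaussianPDFReal]
    simp only [hθdef]
    ring
  simp only [hdiv] at hint ⊢
  refine integral_divergence_eq_zero_of_hasCompactSupport (fun x => ?_) ?_ hint
  · have := (hθ (∑ j, x j ^ 2)).differentiableAt
    have hs : DifferentiableAt ℝ (fun y : Fin d → ℝ => ∑ j, y j ^ 2) x := by fun_prop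
    exact (this.comp x hs).smul (hdiff x)
  · refine HasCompactSupport.intro (isCompact_closedBall 0 (√a⁻¹)) fun x hx => ?_
    have hle : a⁻¹ ≤ ∑ j, x j ^ 2 := by
      by_contra! hlt
      refine hx (mem_closedBall_zero_iff.2 ((pi_norm_le_iff_of_nonneg (by positivity)).2
        fun i => Real.abs_le_sqrt ?_))
      exact (Finset.single_le_sum (f := fun j => x j ^ 2) (fun j _ => sq_nonneg _)
        (Finset.mem_univ i)).trans hlt.le
    have h1 : 1 - a * ∑ j, x j ^ 2 ≤ 0 := by
      rw [sub_nonpos, ← inv_mul_le_iff₀ (by positivity)]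
      simpa using hle
    simp [hθdef, max_eq_left h1]

/-- Stein's lemma for vector fields. Let `γ` be the standard Gaussian measure
on `ℝ^d` (the `d`-fold product of `N(0,1)`) and let `h : ℝ^d → ℝ^d` be differentiable with
Jacobian `J_h x` (whose `(i, j)` entry is `(fderiv ℝ h x (Pi.single j 1)) i`). If
`x ↦ ⟨x, h x⟩` and `x ↦ Tr (J_h x)` are `γ`-integrable, then
`∫ ⟨x, h x⟩ dγ = ∫ Tr (J_h x) dγ`. -/
theorem stein_lemma_vector_field
    {d : ℕ}
    (h : (Fin d → ℝ) → (Fin d → ℝ)) (hdiff : Differentiable ℝ h)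
    (hint1 : Integrable (fun x => ∑ i, x i * h x i)
      (Measure.pi fun _ : Fin d => gaussianReal 0 1))
    (hint2 : Integrable (fun x => ∑ i, fderiv ℝ h x (Pi.single i 1) i)
      (Measure.pi fun _ : Fin d => gaussianReal 0 1)) :
    ∫ x, (∑ i, x i * h x i) ∂(Measure.pi fun _ : Fin d => gaussianReal 0 1) =
      ∫ x, (∑ i, fderiv ℝ h x (Pi.single i 1) i)
        ∂(Measure.pi fun _ : Fin d => gaussianReal 0 1) := by
  set γ := Measure.pi fun _ : Fin d => gaussianReal 0 1
  let a (n : ℕ) : ℝ := 1 / ((n : ℝ) + 1)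
  let m (n : ℕ) (x : Fin d → ℝ) : ℝ := max 0 (1 - a n * ∑ i, x i ^ 2)
  let T (x : Fin d → ℝ) : ℝ := ∑ i, fderiv ℝ h x (Pi.single i 1) i
  let D (x : Fin d → ℝ) : ℝ := ∑ i, x i * h x i
  have ha0 (n) : 0 < a n := Nat.one_div_pos_of_nat
  have ha1 (n) : a n ≤ 1 := by
    simpa [a] using Nat.one_div_le_one_div (α := ℝ) (Nat.zero_le n)
  have hm0 (n x) : 0 ≤ m n x := le_max_left _ _
  have hm1 (n x) : m n x ≤ 1 := by
    have : 0 ≤ a n * ∑ i, x i ^ 2 :=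
      mul_nonneg (ha0 n).le (Finset.sum_nonneg fun i _ => sq_nonneg _)
    exact max_le zero_le_one (by linarith)
  have hmc (n) : Continuous (m n) := by fun_prop
  have hmeas (n) : AEStronglyMeasurable
      (fun x => m n x ^ 2 * T x - (m n x ^ 2 + 4 * a n * m n x) * D x) γ :=
    (((hmc n).pow 2).aestronglyMeasurable.mul hint2.1).sub
      ((by fun_prop : Continuous fun x => m n x ^ 2 + 4 * a n * m n x).aestronglyMeasurable.mul
        hint1.1)
  have hbound (n x) :
      ‖m n x ^ 2 * T x - (m n x ^ 2 + 4 * a n * m n x) * D x‖ ≤ ‖T x‖ + 5 * ‖D x‖ := by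
    have hsq : m n x ^ 2 ≤ 1 := pow_le_one₀ (hm0 n x) (hm1 n x)
    have hmul : a n * m n x ≤ 1 := mul_le_one₀ (ha1 n) (hm0 n x) (hm1 n x)
    have hmul0 : 0 ≤ a n * m n x := mul_nonneg (ha0 n).le (hm0 n x)
    refine (norm_sub_le _ _).trans (add_le_add ?_ ?_)
    · rw [norm_mul, Real.norm_of_nonneg (sq_nonneg _)]
      exact mul_le_of_le_one_left (norm_nonneg _) hsq
    · rw [norm_mul, Real.norm_of_nonneg (by nlinarith [sq_nonneg (m n x)])]
      exact mul_le_mul_of_nonneg_right (by linarith) (norm_nonneg _)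
  have hG : Integrable (fun x => ‖T x‖ + 5 * ‖D x‖) γ := hint2.norm.add (hint1.norm.const_mul 5)
  have ha : Filter.Tendsto a Filter.atTop (nhds 0) := tendsto_one_div_add_atTop_nhds_zero_nat
  have hm (x) : Filter.Tendsto (m · x) Filter.atTop (nhds 1) := by
    simpa using (tendsto_const_nhds (x := (0 : ℝ))).max
      ((tendsto_const_nhds (x := (1 : ℝ))).sub (ha.mul_const (∑ i, x i ^ 2)))
  have hlim : Filter.Tendsto
      (fun n => ∫ x, (m n x ^ 2 * T x - (m n x ^ 2 + 4 * a n * m n x) * D x) ∂γ)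
      Filter.atTop (nhds (∫ x, (T x - D x) ∂γ)) := by
    refine tendsto_integral_of_dominated_convergence _ hmeas hG
      (fun n => ae_of_all _ (hbound n)) (ae_of_all _ fun x => ?_)
    simpa using (((hm x).pow 2).mul_const (T x)).sub
      ((((hm x).pow 2).add ((ha.const_mul 4).mul (hm x))).mul_const (D x))
  have hzero (n) : ∫ x, (m n x ^ 2 * T x - (m n x ^ 2 + 4 * a n * m n x) * D x) ∂γ = 0 :=
    integral_cutoff_stein hdiff (ha0 n) (hG.mono' (hmeas n) (ae_of_all _ (hbound n)))
  simp_rw [hzero] at hlim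
  have hsub := tendsto_nhds_unique hlim tendsto_const_nhds
  rw [integral_sub hint2 hint1, sub_eq_zero] at hsub
  exact hsub.symm
end

section
/- Let μ be a probability measure on a measurable space, r a measurable real-valued function, and α > 0 a real number such that Z := ∫ exp(r(x)/α) dμ(x) is finite and positive. Define the tilted probability measure ν := Z⁻¹ · (μ with density exp(r/α)). Then for every probability measure q that is absolutely continuous with respect to μ, with D_KL(q‖μ) finite and r integrable with respect to q, one has D_KL(q‖ν) = D_KL(q‖μ) − (1/α)·∫ r dq + log Z. -/
open MeasureTheory Classical

/-- The Kullback–Leibler divergence `D_KL(q‖p) = ∫ log (dq/dp) dq` if `q ≪ p` (and the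
log-likelihood ratio is integrable), and `+∞` otherwise. -/
noncomputable def klDiv {X : Type*} [MeasurableSpace X] (q p : Measure X) : EReal :=
  if q ≪ p ∧ Integrable (llr q p) q then ((∫ x, llr q p x ∂q : ℝ) : EReal) else ⊤

theorem inv_smul_withDensity_exp_eq_tilted {X : Type*} [MeasurableSpace X] (μ : Measure X)
    (f : X → ℝ) (hZ : 0 < ∫ x, Real.exp (f x) ∂μ) :
    (ENNReal.ofReal (∫ x, Real.exp (f x) ∂μ))⁻¹ •
      μ.withDensity (fun x => ENNReal.ofReal (Real.exp (f x))) = μ.tilted f := by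
  rw [Measure.tilted, ← withDensity_smul' _ _ (by simpa using hZ)]
  congr 1 with x
  rw [Pi.smul_apply, smul_eq_mul, ENNReal.ofReal_div_of_pos hZ, div_eq_mul_inv, mul_comm]

theorem klDiv_of_ac_of_integrable {X : Type*} [MeasurableSpace X] {q p : Measure X}
    (hac : q ≪ p) (hint : Integrable (llr q p) q) :
    klDiv q p = ((∫ x, llr q p x ∂q : ℝ) : EReal) :=
  if_pos ⟨hac, hint⟩

/-- Let `μ` be a probability measure, `r` a measurable real function and
`α > 0` with `Z = ∫ exp (r x / α) dμ` finite (i.e. the integrand is integrable) and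
positive. For the tilted probability measure `ν = Z⁻¹ • (μ with density exp (r / α))` and
any probability measure `q ≪ μ` with `D_KL(q‖μ)` finite and `r` `q`-integrable, one has
`D_KL(q‖ν) = D_KL(q‖μ) - (1/α) ∫ r dq + log Z`. -/
theorem klDiv_tilted_eq
    {X : Type*} [MeasurableSpace X] (μ : Measure X) [IsProbabilityMeasure μ]
    (r : X → ℝ) (hr : Measurable r) (α : ℝ) (hα : 0 < α)
    (hZ_int : Integrable (fun x => Real.exp (r x / α)) μ)
    (hZ_pos : 0 < ∫ x, Real.exp (r x / α) ∂μ)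
    (q : Measure X) [IsProbabilityMeasure q] (hq_ac : q ≪ μ)
    (hq_fin : klDiv q μ ≠ ⊤) (hq_r : Integrable r q) :
    klDiv q ((ENNReal.ofReal (∫ x, Real.exp (r x / α) ∂μ))⁻¹ •
        μ.withDensity (fun x => ENNReal.ofReal (Real.exp (r x / α)))) =
      klDiv q μ - (((1 / α) * ∫ x, r x ∂q : ℝ) : EReal) +
        ((Real.log (∫ x, Real.exp (r x / α) ∂μ) : ℝ) : EReal) := by
  have h_llr : Integrable (llr q μ) q := by
    by_contra h
    exact hq_fin (if_neg fun h' => h h'.2)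
  have hr_div : Integrable (fun x => r x / α) q := hq_r.div_const α
  rw [inv_smul_withDensity_exp_eq_tilted μ _ hZ_pos,
    klDiv_of_ac_of_integrable (hq_ac.trans (absolutelyContinuous_tilted hZ_int))
      (integrable_llr_tilted_right hq_ac hr_div h_llr hZ_int),
    klDiv_of_ac_of_integrable hq_ac h_llr,
    integral_llr_tilted_right hq_ac hr_div hZ_int h_llr, integral_div,
    div_eq_inv_mul, ← one_div, EReal.coe_add, EReal.coe_sub]
end

section
/- Let P₀ be a probability measure on a measurable space X, g : X → Y measurable, r : Y → ℝ measurable, and α > 0 such that Z := ∫ exp(r(g(x))/α) dP₀(x) is finite and positive. Define P₀⋆ := Z⁻¹ · (P₀ with density x ↦ exp(r(g(x))/α)). Then for every probability measure Q on X that is absolutely continuous with respect to P₀, with r∘g integrable with respect to Q, and whose pushforward satisfies g_♯Q = g_♯P₀⋆, one has D_KL(P₀⋆‖P₀) ≤ D_KL(Q‖P₀); moreover D_KL(Q‖P₀) = D_KL(Q‖P₀⋆) + D_KL(P₀⋆‖P₀), so equality with both sides finite holds if and only if Q = P₀⋆. -/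
open MeasureTheory Classical

/-- The tilted noise measure `P₀⋆ = Z⁻¹ • (P₀ with density x ↦ exp (r (g x) / α))`, where
`Z = ∫ exp (r (g x) / α) dP₀`. -/
noncomputable def tiltedNoise {X Y : Type*} [MeasurableSpace X]
    (P₀ : Measure X) (g : X → Y) (r : Y → ℝ) (α : ℝ) : Measure X :=
  (ENNReal.ofReal (∫ x, Real.exp (r (g x) / α) ∂P₀))⁻¹ •
    P₀.withDensity (fun x => ENNReal.ofReal (Real.exp (r (g x) / α)))

section KullbackLeibler

variable {X : Type*} [MeasurableSpace X] {p q : Measure X} {f : X → ℝ}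

lemma klDiv_eq_coe_informationTheory_klDiv [IsProbabilityMeasure q] [IsProbabilityMeasure p] :
    klDiv q p = (InformationTheory.klDiv q p : EReal) := by
  by_cases h : q ≪ p ∧ Integrable (llr q p) q
  · have htop := InformationTheory.klDiv_ne_top h.1 h.2
    rw [klDiv, if_pos h, ← InformationTheory.toReal_klDiv_of_measure_eq h.1 (by simp),
      EReal.coe_ennreal_toReal htop]
  · rw [klDiv, if_neg h, InformationTheory.klDiv_eq_top_iff.2 (fun h₁ h₂ => h ⟨h₁, h₂⟩),
      EReal.coe_ennreal_top]

lemma klDiv_nonneg [IsProbabilityMeasure q] [IsProbabilityMeasure p] : 0 ≤ klDiv q p := by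
  rw [klDiv_eq_coe_informationTheory_klDiv]
  exact EReal.coe_ennreal_nonneg _

lemma klDiv_eq_zero_iff [IsProbabilityMeasure q] [IsProbabilityMeasure p] :
    klDiv q p = 0 ↔ q = p := by
  rw [klDiv_eq_coe_informationTheory_klDiv, EReal.coe_ennreal_eq_zero,
    InformationTheory.klDiv_eq_zero_iff]

lemma klDiv_tilted_self [IsProbabilityMeasure p]
    (hexp : Integrable (fun x => Real.exp (f x)) p) (hf : Integrable f (p.tilted f)) :
    klDiv (p.tilted f) p =
      ((∫ x, f x ∂(p.tilted f) - Real.log (∫ x, Real.exp (f x) ∂p) : ℝ) : EReal) := by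
  have := isProbabilityMeasure_tilted hexp
  have hac := tilted_absolutelyContinuous p f
  have hllr : llr (p.tilted f) p =ᵐ[p.tilted f]
      fun x => f x - Real.log (∫ x, Real.exp (f x) ∂p) :=
    hac.ae_le (log_rnDeriv_tilted_left_self hexp)
  have hint : Integrable (llr (p.tilted f) p) (p.tilted f) :=
    (integrable_congr hllr).2 (hf.sub (integrable_const _))
  rw [klDiv, if_pos ⟨hac, hint⟩, integral_congr_ae hllr, integral_sub hf (integrable_const _)]
  simp

lemma integrable_llr_tilted_right_iff [IsFiniteMeasure q] [SigmaFinite p] (hac : q ≪ p)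
    (hexp : Integrable (fun x => Real.exp (f x)) p) (hf : Integrable f q) :
    Integrable (llr q (p.tilted f)) q ↔ Integrable (llr q p) q := by
  rw [integrable_congr (llr_tilted_right hac hexp)]
  exact integrable_add_iff_integrable_right' (hf.neg.add (integrable_const _))

/-- Pythagorean identity for exponential tilting. -/
lemma klDiv_eq_klDiv_tilted_add [IsProbabilityMeasure q] [IsProbabilityMeasure p] (hac : q ≪ p)
    (hexp : Integrable (fun x => Real.exp (f x)) p) (hf : Integrable f q)
    (hft : Integrable f (p.tilted f)) (hmean : ∫ x, f x ∂q = ∫ x, f x ∂(p.tilted f)) :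
    klDiv q p = klDiv q (p.tilted f) + klDiv (p.tilted f) p := by
  have hact : q ≪ p.tilted f := hac.trans (absolutelyContinuous_tilted hexp)
  rw [klDiv_tilted_self hexp hft]
  by_cases hint : Integrable (llr q p) q
  · have hintt := (integrable_llr_tilted_right_iff hac hexp hf).2 hint
    rw [klDiv, klDiv, if_pos ⟨hac, hint⟩, if_pos ⟨hact, hintt⟩,
      integral_llr_tilted_right hac hf hexp hint, hmean, ← EReal.coe_add]
    congr 1
    ring
  · have hintt := (integrable_llr_tilted_right_iff hac hexp hf).not.2 hint
    rw [klDiv, klDiv, if_neg (fun h => hint h.2), if_neg (fun h => hintt h.2),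
      EReal.top_add_coe]

end KullbackLeibler

lemma tiltedNoise_eq_tilted {X Y : Type*} [MeasurableSpace X] {P₀ : Measure X} {g : X → Y}
    {r : Y → ℝ} {α : ℝ} (hZ_pos : 0 < ∫ x, Real.exp (r (g x) / α) ∂P₀) :
    tiltedNoise P₀ g r α = P₀.tilted (fun x => r (g x) / α) := by
  rw [tiltedNoise, Measure.tilted, ← withDensity_smul' _ _ (by simpa using hZ_pos)]
  congr 1
  ext x
  rw [Pi.smul_apply, smul_eq_mul, ENNReal.ofReal_div_of_pos hZ_pos, ENNReal.div_eq_inv_mul]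

/-- The tilted noise measure `P₀⋆` is the KL projection of `P₀` onto the set
of measures pushing forward to `g_♯P₀⋆`: for every probability measure `Q ≪ P₀` with
`r ∘ g` `Q`-integrable and `g_♯Q = g_♯P₀⋆`, one has `D_KL(P₀⋆‖P₀) ≤ D_KL(Q‖P₀)`; moreover
`D_KL(Q‖P₀) = D_KL(Q‖P₀⋆) + D_KL(P₀⋆‖P₀)`, so (when `D_KL(P₀⋆‖P₀)` is finite) equality
with both sides finite holds if and only if `Q = P₀⋆`. -/
theorem tilted_noise_is_kl_projection
    {X Y : Type*} [MeasurableSpace X] [MeasurableSpace Y]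
    (P₀ : Measure X) [IsProbabilityMeasure P₀]
    (g : X → Y) (hg : Measurable g) (r : Y → ℝ) (hr : Measurable r)
    (α : ℝ) (hα : 0 < α)
    (hZ_int : Integrable (fun x => Real.exp (r (g x) / α)) P₀)
    (hZ_pos : 0 < ∫ x, Real.exp (r (g x) / α) ∂P₀)
    (Q : Measure X) [IsProbabilityMeasure Q] (hQ_ac : Q ≪ P₀)
    (hQ_r : Integrable (fun x => r (g x)) Q)
    (hQ_push : Measure.map g Q = Measure.map g (tiltedNoise P₀ g r α)) :
    klDiv (tiltedNoise P₀ g r α) P₀ ≤ klDiv Q P₀ ∧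
    klDiv Q P₀ = klDiv Q (tiltedNoise P₀ g r α) + klDiv (tiltedNoise P₀ g r α) P₀ ∧
    (klDiv (tiltedNoise P₀ g r α) P₀ ≠ ⊤ →
      (klDiv Q P₀ = klDiv (tiltedNoise P₀ g r α) P₀ ↔ Q = tiltedNoise P₀ g r α)) := by
  rw [tiltedNoise_eq_tilted hZ_pos] at hQ_push ⊢
  set f : X → ℝ := fun x => r (g x) / α
  have : IsProbabilityMeasure (P₀.tilted f) := isProbabilityMeasure_tilted hZ_int
  have hh : Measurable fun y => r y / α := hr.div_const α
  have hfQ : Integrable f Q := hQ_r.div_const α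
  have hfT : Integrable f (P₀.tilted f) := by
    have hmap : Integrable (fun y => r y / α) (Measure.map g Q) :=
      (integrable_map_measure hh.aestronglyMeasurable hg.aemeasurable).2 hfQ
    rw [hQ_push] at hmap
    exact hmap.comp_measurable hg
  have hmean : ∫ x, f x ∂Q = ∫ x, f x ∂(P₀.tilted f) := by
    rw [← integral_map hg.aemeasurable hh.aestronglyMeasurable, hQ_push,
      integral_map hg.aemeasurable hh.aestronglyMeasurable]
  have hpyth := klDiv_eq_klDiv_tilted_add hQ_ac hZ_int hfQ hfT hmean
  refine ⟨?_, hpyth, fun _ => ⟨fun heq => ?_, fun heq => by rw [heq]⟩⟩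
  · rw [hpyth]
    exact le_add_of_nonneg_left klDiv_nonneg
  · rw [hpyth, klDiv_tilted_self hZ_int hfT] at heq
    generalize ((∫ x, f x ∂(P₀.tilted f)) - Real.log (∫ x, Real.exp (f x) ∂P₀)) = c at heq
    refine klDiv_eq_zero_iff.1 ?_
    rw [← EReal.add_sub_cancel_right (a := klDiv Q (P₀.tilted f)) (b := c), heq,
      ← EReal.coe_sub, sub_self, EReal.coe_zero]
end

section
/- Let μ and ν be probability measures on a measurable space X and let g : X → Y be a measurable map into a measurable space Y. Then the Kullback–Leibler divergence satisfies the data processing inequality: D_KL(g_♯μ‖g_♯ν) ≤ D_KL(μ‖ν). -/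
open MeasureTheory Classical

/-- Data processing inequality for the Kullback–Leibler divergence. For
probability measures `μ, ν` on `X` and a measurable map `g : X → Y`,
`D_KL(g_♯μ ‖ g_♯ν) ≤ D_KL(μ ‖ ν)`. -/
theorem klDiv_data_processing_inequality
    {X Y : Type*} [MeasurableSpace X] [MeasurableSpace Y]
    (μ ν : Measure X) [IsProbabilityMeasure μ] [IsProbabilityMeasure ν]
    (g : X → Y) (hg : Measurable g) :
    klDiv (Measure.map g μ) (Measure.map g ν) ≤ klDiv μ ν := by
  unfold klDiv
  split_ifs with h_map h h
  · have : IsProbabilityMeasure (μ.map g) := Measure.isProbabilityMeasure_map hg.aemeasurable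
    have : IsProbabilityMeasure (ν.map g) := Measure.isProbabilityMeasure_map hg.aemeasurable
    rw [EReal.coe_le_coe_iff,
      ← InformationTheory.toReal_klDiv_of_measure_eq h_map.1 (by simp),
      ← InformationTheory.toReal_klDiv_of_measure_eq h.1 (by simp)]
    exact ENNReal.toReal_mono (InformationTheory.klDiv_ne_top h.1 h.2)
      (InformationTheory.klDiv_map_le μ ν hg)
  · exact le_top
  · exact absurd ⟨h.1.map hg, InformationTheory.integrable_llr_map h.1 hg h.2⟩ h_map
  · exact le_rfl
end
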